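/- arXiv:2601.15464 — 2 statements merged into one kernel-verified Lean document; each statement's English description precedes it below -/
import Mathlib

section
/- Let L/K be a finite Galois extension of degree m whose Galois group is cyclic with generator σ, and let d be a positive integer with d ≤ m. Then the set G_d of all K-linear endomorphisms of L of the form β ↦ Σ_{i=0}^{m−d} a_i · σ^i(β) with a_0, ..., a_{m−d} ∈ L is a K-linear subspace of End_K(L) of K-dimension m·(m − d + 1), and every nonzero element of G_d has kernel of K-dimension at most m − d (equivalently, its image has K-dimension at least d). In particular, G_d is an MRD code of minimum rank distance d. -/
/-- The `K`-linear endomorphism of `L` given by `β ↦ ∑_{i=0}^{t} a_i * σ^i(β)`. -/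
noncomputable def sigmaPoly {K L : Type*} [Field K] [Field L] [Algebra K L]
    (σ : L ≃ₐ[K] L) (t : ℕ) (a : ℕ → L) : L →ₗ[K] L where
  toFun β := ∑ i ∈ Finset.range (t + 1), a i * (σ ^ i) β
  map_add' := by
    intro x y
    simp [map_add, mul_add, Finset.sum_add_distrib]
  map_smul' := by
    intro c x
    simp [map_smul, mul_smul_comm, Finset.smul_sum]

/-- The Delsarte–Gabidulin code `G_d`: all endomorphisms of the form
`β ↦ ∑_{i=0}^{m-d} a_i σ^i(β)`, as a `K`-subspace of `End_K(L)`. -/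
noncomputable def gabidulinCode {K L : Type*} [Field K] [Field L] [Algebra K L]
    (σ : L ≃ₐ[K] L) (m d : ℕ) : Submodule K (L →ₗ[K] L) where
  carrier := {φ | ∃ a : ℕ → L, φ = sigmaPoly σ (m - d) a}
  add_mem' := by
    rintro φ₁ φ₂ ⟨a, rfl⟩ ⟨b, rfl⟩
    refine ⟨a + b, ?_⟩
    ext β
    simp [sigmaPoly, add_mul, Finset.sum_add_distrib]
  zero_mem' := by
    refine ⟨0, ?_⟩
    ext β
    simp [sigmaPoly]
  smul_mem' := by
    rintro c φ ⟨a, rfl⟩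
    refine ⟨c • a, ?_⟩
    ext β
    simp [sigmaPoly, smul_mul_assoc, Finset.smul_sum]

theorem gab_abel {L : Type*} [Field L] (b s : ℕ → L) (n : ℕ) :
    ∑ i ∈ Finset.range n, (-∑ j ∈ Finset.range (i + 1), b j) * (s (i + 1) - s i) =
      ∑ i ∈ Finset.range (n + 1), b i * s i - (∑ i ∈ Finset.range (n + 1), b i) * s n := by
  induction n with
  | zero => simp
  | succ n ih =>
    rw [Finset.sum_range_succ, ih, Finset.sum_range_succ _ (n + 1),
      Finset.sum_range_succ b (n + 1)]
    ring

theorem gab_fixed {K L : Type*} [Field K] [Field L] [Algebra K L]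
    [FiniteDimensional K L] [IsGalois K L]
    (σ : L ≃ₐ[K] L) (hσ : ∀ g : L ≃ₐ[K] L, g ∈ Subgroup.zpowers σ) (x : L) (hx : σ x = x) :
    ∃ c : K, algebraMap K L c = x := by
  have h : x ∈ (⊥ : IntermediateField K L) := by
    rw [IsGalois.mem_bot_iff_fixed]
    intro g
    have h1 : Subgroup.zpowers σ ≤ MulAction.stabilizer (L ≃ₐ[K] L) x := by
      rw [Subgroup.zpowers_le, MulAction.mem_stabilizer_iff]
      exact hx
    exact MulAction.mem_stabilizer_iff.1 (h1 (hσ g))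
  exact IntermediateField.mem_bot.1 h

theorem gab_key {K L : Type*} [Field K] [Field L] [Algebra K L]
    [FiniteDimensional K L] [IsGalois K L]
    (σ : L ≃ₐ[K] L) (hσ : ∀ g : L ≃ₐ[K] L, g ∈ Subgroup.zpowers σ) (t : ℕ) :
    ∀ (a : ℕ → L) (V : Submodule K L), t < Module.finrank K V →
      (∀ v ∈ V, ∑ i ∈ Finset.range (t + 1), a i * (σ ^ i) v = 0) →
      ∀ i < t + 1, a i = 0 := by
  induction t with
  | zero =>
    intro a V hV h i hi
    obtain rfl : i = 0 := by omega
    have hne : V ≠ ⊥ := by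
      rintro rfl
      simp at hV
    obtain ⟨v, hv, hv0⟩ := Submodule.exists_mem_ne_zero_of_ne_bot hne
    have := h v hv
    simpa [hv0] using this
  | succ t ih =>
    intro a V hV h
    have hne : V ≠ ⊥ := by
      rintro rfl
      simp at hV
    obtain ⟨v, hv, hv0⟩ := Submodule.exists_mem_ne_zero_of_ne_bot hne
    let T : L →ₗ[K] L := (σ.toLinearMap - LinearMap.id) ∘ₗ LinearMap.mulLeft K v⁻¹
    have hT : ∀ x, T x = σ (v⁻¹ * x) - v⁻¹ * x := fun x => rfl
    have hker : LinearMap.ker T ≤ Submodule.span K {v} := by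
      intro x hx
      rw [LinearMap.mem_ker, hT, sub_eq_zero] at hx
      obtain ⟨c, hc⟩ := gab_fixed σ hσ _ hx
      rw [Submodule.mem_span_singleton]
      refine ⟨c, ?_⟩
      rw [Algebra.smul_def, hc]
      field_simp
    have hk1 : Module.finrank K (LinearMap.ker (T.domRestrict V)) ≤ 1 := by
      have e : Module.finrank K ((LinearMap.ker (T.domRestrict V)).map V.subtype)
          = Module.finrank K (LinearMap.ker (T.domRestrict V)) := by
        exact (Submodule.equivMapOfInjective _ V.injective_subtype _).finrank_eq.symm
      rw [← e]
      refine (Submodule.finrank_mono (t := Submodule.span K {v}) ?_).trans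
        (finrank_span_singleton hv0).le
      rintro _ ⟨y, hy, rfl⟩
      exact hker hy
    have hU : t < Module.finrank K (V.map T) := by
      have h1 := LinearMap.finrank_range_add_finrank_ker (T.domRestrict V)
      rw [LinearMap.range_domRestrict] at h1
      omega
    set b : ℕ → L := fun i => a i * (σ ^ i) v with hb
    have hb0 : ∑ i ∈ Finset.range (t + 1 + 1), b i = 0 := h v hv
    have hc := ih (fun i => -∑ j ∈ Finset.range (i + 1), b j) (V.map T) hU (by
      rintro _ ⟨β, hβ, rfl⟩
      have h2 := gab_abel b (fun i => (σ ^ i) (v⁻¹ * β)) (t + 1)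
      rw [hb0, zero_mul, sub_zero] at h2
      have h3 : ∑ i ∈ Finset.range (t + 1 + 1), b i * (σ ^ i) (v⁻¹ * β) = 0 := by
        rw [← h β hβ]
        refine Finset.sum_congr rfl fun i _ => ?_
        rw [hb]
        simp only
        rw [mul_assoc, ← map_mul, mul_inv_cancel_left₀ hv0]
      rw [h3] at h2
      rw [← h2]
      refine Finset.sum_congr rfl fun i _ => ?_
      rw [hT, map_sub, pow_succ, AlgEquiv.mul_apply])
    have hB : ∀ i ≤ t + 1 + 1, ∑ j ∈ Finset.range i, b j = 0 := by
      intro i hi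
      rcases Nat.eq_zero_or_pos i with rfl | hp
      · simp
      rcases Nat.lt_or_ge i (t + 1 + 1) with hlt | hge
      · have := hc (i - 1) (by omega)
        simp only [neg_eq_zero] at this
        rwa [Nat.sub_add_cancel hp] at this
      · rw [le_antisymm hi hge]
        exact hb0
    intro i hi
    have h4 := hB (i + 1) (by omega)
    rw [Finset.sum_range_succ, hB i (by omega), zero_add] at h4
    have h5 : (σ ^ i) v ≠ 0 := (map_ne_zero_iff _ (σ ^ i).injective).2 hv0
    exact (mul_eq_zero.1 h4).resolve_right h5

theorem gab_ext {K L : Type*} [Field K] [Field L] [Algebra K L]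
    (σ : L ≃ₐ[K] L) (t : ℕ) (a b : ℕ → L) (h : ∀ i < t + 1, a i = b i) :
    sigmaPoly σ t a = sigmaPoly σ t b := by
  ext β
  change ∑ i ∈ Finset.range (t + 1), a i * (σ ^ i) β = ∑ i ∈ Finset.range (t + 1), b i * (σ ^ i) β
  exact Finset.sum_congr rfl fun i hi => by rw [h i (Finset.mem_range.1 hi)]

/-- coefficients to endomorphism -/
noncomputable def gabMap {K L : Type*} [Field K] [Field L] [Algebra K L]
    (σ : L ≃ₐ[K] L) (t : ℕ) : (Fin (t + 1) → L) →ₗ[K] (L →ₗ[K] L) where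
  toFun a := sigmaPoly σ t (fun i => if h : i < t + 1 then a ⟨i, h⟩ else 0)
  map_add' a b := by
    ext β
    simp only [sigmaPoly, LinearMap.coe_mk, AddHom.coe_mk, LinearMap.add_apply]
    rw [← Finset.sum_add_distrib]
    refine Finset.sum_congr rfl fun i hi => ?_
    simp [Finset.mem_range.1 hi, add_mul]
  map_smul' c a := by
    ext β
    simp only [sigmaPoly, LinearMap.coe_mk, AddHom.coe_mk, LinearMap.smul_apply, RingHom.id_apply]
    rw [Finset.smul_sum]
    refine Finset.sum_congr rfl fun i hi => ?_
    simp [Finset.mem_range.1 hi]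

/-- the Delsarte–Gabidulin code `G_d` is a `K`-subspace of
`End_K(L)` of dimension `m(m - d + 1)` all of whose nonzero elements have
kernel of dimension at most `m - d` (equivalently, image of dimension at
least `d`); in particular it is an MRD code of minimum rank distance `d`. -/
theorem gabidulin_MRD (K L : Type*) [Field K] [Field L] [Algebra K L]
    [FiniteDimensional K L] [IsGalois K L] (m : ℕ) (hm : Module.finrank K L = m)
    (σ : L ≃ₐ[K] L) (hσ : ∀ g : L ≃ₐ[K] L, g ∈ Subgroup.zpowers σ)
    (d : ℕ) (hd : 0 < d) (hdm : d ≤ m) :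
    Module.finrank K (gabidulinCode σ m d) = m * (m - d + 1) ∧
      ∀ φ ∈ gabidulinCode σ m d, φ ≠ 0 →
        Module.finrank K (LinearMap.ker φ) ≤ m - d ∧
          d ≤ Module.finrank K (LinearMap.range φ) := by
  have hrank : ∀ φ ∈ gabidulinCode σ m d, φ ≠ 0 →
      Module.finrank K (LinearMap.ker φ) ≤ m - d := by
    rintro φ ⟨a, rfl⟩ h0
    by_contra hcon
    push Not at hcon
    refine h0 ?_
    have h1 := gab_key σ hσ (m - d) a (LinearMap.ker (sigmaPoly σ (m - d) a)) hcon
      (fun v hv => hv)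
    rw [gab_ext σ (m - d) a 0 h1]
    ext β
    simp [sigmaPoly]
  refine ⟨?_, fun φ hφ h0 => ?_⟩
  · have hr : LinearMap.range (gabMap σ (m - d)) = gabidulinCode σ m d := by
      ext φ
      constructor
      · rintro ⟨a, rfl⟩
        exact ⟨_, rfl⟩
      · rintro ⟨a, rfl⟩
        refine ⟨fun i => a i, ?_⟩
        refine gab_ext σ _ _ _ fun i hi => ?_
        simp [hi]
    have hinj : Function.Injective (gabMap σ (m - d)) := by
      rw [← LinearMap.ker_eq_bot, LinearMap.ker_eq_bot']
      intro a ha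
      have h1 := gab_key σ hσ (m - d) (fun i => if h : i < m - d + 1 then a ⟨i, h⟩ else 0) ⊤
        (by rw [finrank_top]; omega) (fun v _ => LinearMap.congr_fun ha v)
      funext i
      have := h1 i i.2
      rw [dif_pos i.2] at this
      exact this
    rw [← hr, LinearMap.finrank_range_of_inj hinj, Module.finrank_pi_fintype]
    simp [hm, mul_comm]
  · have h1 := hrank φ hφ h0
    have h2 := LinearMap.finrank_range_add_finrank_ker φ
    exact ⟨h1, by omega⟩
end

section
/- Let K be an algebraically closed field and let m, n, d be positive integers with d ≤ min(m,n). If C is a K-linear subspace of the space of m×n matrices over K such that every nonzero matrix in C has rank at least d, then dim_K C ≤ (m − d + 1)·(n − d + 1). -/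
open Matrix

lemma exists_rows_li {K ι κ : Type*} [Field K] [Fintype ι] [Fintype κ]
    (A : Matrix ι κ K) (d : ℕ) (h : d ≤ A.rank) :
    ∃ f : Fin d → ι, LinearIndependent K (fun i => A (f i)) := by
  classical
  rw [Matrix.rank_eq_finrank_span_row] at h
  obtain ⟨s, hs1, hs2, hs3⟩ := exists_linearIndependent K (Set.range A.row)
  have hfin : s.Finite := (Set.finite_range _).subset hs1
  have : Fintype s := hfin.fintype
  have hcard : d ≤ Fintype.card s := by
    rw [← hs2, finrank_span_set_eq_card hs3, Set.toFinset_card] at h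
    exact h
  obtain ⟨e⟩ : Nonempty (Fin d ↪ s) :=
    Function.Embedding.nonempty_of_card_le (by simpa using hcard)
  choose g hg using fun x : s => hs1 x.2
  refine ⟨fun i => g (e i), ?_⟩
  have := hs3.comp e e.injective
  have h2 : (fun i => A (g (e i))) = Subtype.val ∘ e := funext fun i => hg (e i)
  rw [h2]
  exact this

lemma rank_lt_of_minors {K ι κ : Type*} [Field K] [Fintype ι] [Fintype κ]
    (A : Matrix ι κ K) (d : ℕ)
    (h : ∀ (f : Fin d → ι) (g : Fin d → κ), (A.submatrix f g).det = 0) : A.rank < d := by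
  classical
  by_contra! hd
  obtain ⟨f, hf⟩ := exists_rows_li A d hd
  have h1 : (A.submatrix f id).rank = d := by
    have := LinearIndependent.rank_matrix (M := A.submatrix f id) hf
    simpa using this
  obtain ⟨g, hg⟩ := exists_rows_li (A.submatrix f id)ᵀ d (by rw [rank_transpose, h1])
  have h2 := (Matrix.linearIndependent_rows_iff_isUnit
    (A := (A.submatrix f g)ᵀ)).1 hg
  rw [Matrix.isUnit_iff_isUnit_det, det_transpose, h f g] at h2
  simp at h2

lemma exists_point {K S : Type*} [Field K] [IsAlgClosed K] [CommRing S] [Algebra K S]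
    [Algebra.FiniteType K S] (J : Ideal S) (hJ : J ≠ ⊤) :
    ∃ φ : S →ₐ[K] K, ∀ x ∈ J, φ x = 0 := by
  obtain ⟨N, hN, hle⟩ := J.exists_le_maximal hJ
  let _ : Field (S ⧸ N) := Ideal.Quotient.field N
  have := finite_of_finite_type_of_isJacobsonRing K (S ⧸ N)
  have hb := IsAlgClosed.algebraMap_bijective_of_isIntegral (k := K) (K := S ⧸ N)
  let e : K ≃ₐ[K] (S ⧸ N) := AlgEquiv.ofBijective (Algebra.ofId K (S ⧸ N)) hb
  refine ⟨e.symm.toAlgHom.comp (Ideal.Quotient.mkₐ K N), fun x hx => ?_⟩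
  have : Ideal.Quotient.mkₐ K N x = 0 := Ideal.Quotient.eq_zero_iff_mem.2 (hle hx)
  change e.symm (Ideal.Quotient.mkₐ K N x) = 0
  rw [this, map_zero]

lemma entries_mem {K F ι κ τ : Type*} [Field K] [IsAlgClosed K] [Field F] [Algebra K F]
    [Fintype ι] [Fintype κ] (d : ℕ) (M : Matrix ι κ F)
    (hM : ∀ (f : Fin d → ι) (g : Fin d → κ), (M.submatrix f g).det = 0)
    (c : τ → Matrix ι κ K)
    (hc : ∀ N : Matrix ι κ K, (∀ (f : Fin d → ι) (g : Fin d → κ), (N.submatrix f g).det = 0) →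
      (∀ t, ∑ i, ∑ j, c t i j * N i j = 0) → N = 0)
    (i₀ : ι) (j₀ : κ) :
    IsIntegral (Algebra.adjoin K
      (Set.range fun t => ∑ i, ∑ j, algebraMap K F (c t i j) * M i j)) (M i₀ j₀) := by
  classical
  set B := Algebra.adjoin K
      (Set.range fun t => ∑ i, ∑ j, algebraMap K F (c t i j) * M i j) with hB
  by_contra hInt
  have hmem : M i₀ j₀ ∉ (integralClosure B F).toSubring := hInt
  obtain ⟨V, hV, hx⟩ := Subring.exists_le_valuationSubring_of_isIntegrallyClosedIn hmem
  have hBV : ∀ b ∈ B, b ∈ V := fun b hb =>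
    hV ((integralClosure B F).algebraMap_mem ⟨b, hb⟩)
  have : Nonempty (ι × κ) := ⟨(i₀, j₀)⟩
  obtain ⟨p, hp⟩ := Finite.exists_max (fun p : ι × κ => V.valuation (M p.1 p.2))
  set a := M p.1 p.2 with ha
  have hva : 1 < V.valuation a := by
    rw [← V.valuation_le_one_iff, not_le] at hx
    exact hx.trans_le (hp (i₀, j₀))
  have ha0 : a ≠ 0 := by
    rintro h
    simp [h] at hva
  have hva0 : V.valuation a ≠ 0 := by simpa using ha0
  let S := Algebra.adjoin K (Set.range fun q : ι × κ => a⁻¹ * M q.1 q.2)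
  have hSV : ∀ s ∈ S, s ∈ V := by
    intro s hs
    induction hs using Algebra.adjoin_induction with
    | mem x hx =>
      obtain ⟨q, rfl⟩ := hx
      rw [← V.valuation_le_one_iff]
      simp only [map_mul, map_inv₀]
      rw [inv_mul_le_iff₀ (zero_lt_iff.2 hva0), mul_one]
      exact hp q
    | algebraMap r => exact hBV _ (B.algebraMap_mem r)
    | add x y _ _ hx hy => exact V.add_mem _ _ hx hy
    | mul x y _ _ hx hy => exact V.mul_mem _ _ hx hy
  let ψ : S →+* V := S.val.toRingHom.codRestrict V.toSubring (fun s => hSV _ s.2)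
  let J := (IsLocalRing.maximalIdeal V).comap ψ
  have hJ : J ≠ ⊤ := Ideal.comap_ne_top _ (IsLocalRing.maximalIdeal.isMaximal V).ne_top
  have : Algebra.FiniteType K S :=
    (Subalgebra.fg_iff_finiteType _).1 (Subalgebra.fg_def.2 ⟨_, Set.finite_range _, rfl⟩)
  obtain ⟨φ, hφ⟩ := exists_point (K := K) J hJ
  let N' : Matrix ι κ S := fun i j => ⟨a⁻¹ * M i j, Algebra.subset_adjoin ⟨(i, j), rfl⟩⟩
  have key := hc (N'.map φ) ?_ ?_
  · have h1 : N' p.1 p.2 = 1 := Subtype.ext (inv_mul_cancel₀ ha0)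
    have h2 := congrFun (congrFun key p.1) p.2
    simp [h1] at h2
  · intro f g
    have h1 : (N'.submatrix f g).det = 0 := by
      apply Subtype.ext
      have : S.val.toRingHom (N'.submatrix f g).det = (a⁻¹ • M.submatrix f g).det := by
        rw [RingHom.map_det]
        rfl
      rw [det_smul, hM f g, mul_zero] at this
      exact this
    have h2 := φ.toRingHom.map_det (N'.submatrix f g)
    rw [h1, map_zero] at h2
    exact h2.symm
  · intro t
    have h1 : φ (∑ i, ∑ j, algebraMap K S (c t i j) * N' i j) = 0 := by
      apply hφ
      change ψ _ ∈ IsLocalRing.maximalIdeal V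
      refine (ValuationSubring.valuation_lt_one_iff V _).2 ?_
      have : ((ψ (∑ i, ∑ j, algebraMap K S (c t i j) * N' i j) : V) : F) =
          a⁻¹ * ∑ i, ∑ j, algebraMap K F (c t i j) * M i j := by
        change S.val (∑ i, ∑ j, algebraMap K S (c t i j) * N' i j) = _
        simp only [map_sum, map_mul, Finset.mul_sum]
        refine Finset.sum_congr rfl fun i _ => Finset.sum_congr rfl fun j _ => ?_
        change algebraMap K F (c t i j) * (a⁻¹ * M i j) = _
        ring
      rw [this, map_mul, map_inv₀]
      have h3 : V.valuation (∑ i, ∑ j, algebraMap K F (c t i j) * M i j) ≤ 1 :=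
        (V.valuation_le_one_iff _).2 (hBV _ (Algebra.subset_adjoin ⟨t, rfl⟩))
      rw [inv_mul_lt_iff₀ (zero_lt_iff.2 hva0), mul_one]
      exact h3.trans_lt hva
    simpa using h1

lemma card_le {K τ : Type*} [Field K] [IsAlgClosed K] [Fintype τ] (r a b : ℕ)
    (c : τ → Matrix (Fin r ⊕ Fin a) (Fin r ⊕ Fin b) K)
    (hc : ∀ N : Matrix (Fin r ⊕ Fin a) (Fin r ⊕ Fin b) K, N.rank < r + 1 →
      (∀ t, ∑ i, ∑ j, c t i j * N i j = 0) → N = 0) :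
    r * r + r * b + a * r ≤ Fintype.card τ := by
  classical
  let σ := (Fin r × Fin r) ⊕ (Fin r × Fin b) ⊕ (Fin a × Fin r)
  let P := MvPolynomial σ K
  let F := FractionRing P
  let v : σ → F := algebraMap P F ∘ MvPolynomial.X
  have : Algebra.IsAlgebraic P F := IsLocalization.isAlgebraic F (nonZeroDivisors P)
  have hv : IsTranscendenceBasis K v :=
    (IsTranscendenceBasis.mvPolynomial σ K).algebraMap_comp
  let Y1 : Matrix (Fin r) (Fin r) F := fun i j => v (Sum.inl (i, j))
  let Y2 : Matrix (Fin r) (Fin b) F := fun i j => v (Sum.inr (Sum.inl (i, j)))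
  let Z : Matrix (Fin a) (Fin r) F := fun i j => v (Sum.inr (Sum.inr (i, j)))
  have hY : IsUnit Y1.det := by
    rw [isUnit_iff_ne_zero]
    let g : MvPolynomial (Fin r × Fin r) K →ₐ[K] F :=
      (IsScalarTower.toAlgHom K P F).comp (MvPolynomial.rename Sum.inl)
    have hg : Function.Injective g :=
      (IsFractionRing.injective P F).comp (MvPolynomial.rename_injective _ Sum.inl_injective)
    have h1 : Y1 = g.toRingHom.mapMatrix (mvPolynomialX (Fin r) (Fin r) K) := by
      ext i j
      simp only [Y1, g, v]
      exact congrArg (algebraMap P F) (MvPolynomial.rename_X (R := K) Sum.inl (i, j)).symm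
    rw [h1, ← RingHom.map_det]
    exact fun h => det_mvPolynomialX_ne_zero (Fin r) K (hg (h.trans (map_zero g).symm))
  let M : Matrix (Fin r ⊕ Fin a) (Fin r ⊕ Fin b) F := fromBlocks Y1 Y2 Z (Z * Y1⁻¹ * Y2)
  have hMf : M = fromRows 1 (Z * Y1⁻¹) * fromCols Y1 Y2 := by
    rw [fromRows_mul_fromCols]
    simp [M, Matrix.mul_assoc, Matrix.nonsing_inv_mul _ hY]
  have hM : ∀ (f : Fin (r+1) → Fin r ⊕ Fin a) (g : Fin (r+1) → Fin r ⊕ Fin b),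
      (M.submatrix f g).det = 0 := by
    intro f g
    by_contra h
    have h1 := rank_of_isUnit (M.submatrix f g)
      ((Matrix.isUnit_iff_isUnit_det _).2 (isUnit_iff_ne_zero.2 h))
    have h2 : (M.submatrix f g).rank ≤ r := by
      rw [hMf, ← Matrix.submatrix_mul_equiv _ _ f (Equiv.refl _) g]
      exact (rank_mul_le_left _ _).trans ((rank_le_width _))
    simp at h1
    omega
  have hInt := entries_mem (r+1) M hM c (fun N hN => hc N (rank_lt_of_minors N _ hN))
  set B := Algebra.adjoin K
      (Set.range fun t => ∑ i, ∑ j, algebraMap K F (c t i j) * M i j) with hB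
  have halg : Algebra.IsAlgebraic B F := by
    rw [hv.isAlgebraic_iff]
    rintro (⟨i, j⟩ | ⟨i, j⟩ | ⟨i, j⟩)
    · exact (hInt (Sum.inl i) (Sum.inl j)).isAlgebraic
    · exact (hInt (Sum.inl i) (Sum.inr j)).isAlgebraic
    · exact (hInt (Sum.inr i) (Sum.inl j)).isAlgebraic
  have h1 := Algebra.IsAlgebraic.trdeg_le_cardinalMk K
    (Set.range fun t => ∑ i, ∑ j, algebraMap K F (c t i j) * M i j)
  have h2 := hv.lift_cardinalMk_eq_trdeg
  let w : τ → F := fun t => ∑ i, ∑ j, algebraMap K F (c t i j) * M i j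
  have h3 : Nat.card (Set.range w) ≤ Fintype.card τ := by
    rw [← Nat.card_eq_fintype_card]
    exact Nat.card_le_card_of_surjective _ (Set.rangeFactorization_surjective (f := w))
  have h4 : Cardinal.mk (Set.range w) = (Nat.card (Set.range w) : Cardinal) :=
    Nat.cast_card.symm
  have h5 : Fintype.card σ ≤ Nat.card (Set.range w) := by
    change _ ≤ Cardinal.mk (Set.range w) at h1
    rw [h4] at h1
    rw [Cardinal.mk_fintype, Cardinal.lift_natCast, Cardinal.lift_uzero] at h2
    rw [← h2] at h1
    exact_mod_cast h1
  have h6 : Fintype.card σ = r * r + (r * b + a * r) := by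
    simp [σ]
  omega

/-- bound on rank-metric codes over an algebraically closed field. -/
theorem bound_algebraically_closed (K : Type*) [Field K] [IsAlgClosed K]
    (m n d : ℕ) (hm : 0 < m) (hn : 0 < n) (hd : 0 < d) (hdmn : d ≤ min m n)
    (C : Submodule K (Matrix (Fin m) (Fin n) K))
    (hC : ∀ A ∈ C, A ≠ 0 → d ≤ A.rank) :
    Module.finrank K C ≤ (m - d + 1) * (n - d + 1) := by
  classical
  obtain ⟨r, rfl⟩ : ∃ r, d = r + 1 := ⟨d - 1, by omega⟩
  obtain ⟨a, rfl⟩ : ∃ a, m = r + a := ⟨m - r, by omega⟩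
  obtain ⟨b, rfl⟩ : ∃ b, n = r + b := ⟨n - r, by omega⟩
  rw [show r + a - (r + 1) + 1 = a by omega, show r + b - (r + 1) + 1 = b by omega]
  let V := Matrix (Fin (r + a)) (Fin (r + b)) K
  let bs := Module.finBasis K (V ⧸ C)
  let ℓ : Fin (Module.finrank K (V ⧸ C)) → V →ₗ[K] K := fun t => bs.coord t ∘ₗ C.mkQ
  have key := card_le (τ := Fin (Module.finrank K (V ⧸ C))) (K := K) r a b
    (fun t i j => ℓ t (Matrix.single (finSumFinEquiv i) (finSumFinEquiv j) 1)) ?_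
  · have h1 := C.finrank_quotient_add_finrank
    have h2 : Module.finrank K V = (r + a) * (r + b) := by simp [V, Module.finrank_matrix]
    rw [h2] at h1
    rw [Fintype.card_fin] at key
    nlinarith
  · intro N hN ht
    set N' : V := N.submatrix finSumFinEquiv.symm finSumFinEquiv.symm with hN'
    have hmem : N' ∈ C := by
      rw [← Submodule.Quotient.mk_eq_zero, ← Submodule.mkQ_apply]
      apply bs.ext_elem
      intro t
      rw [map_zero]
      change ℓ t N' = 0
      rw [← ht t]
      conv_lhs => rw [matrix_eq_sum_single N', map_sum]
      rw [← finSumFinEquiv.sum_comp]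
      refine Finset.sum_congr rfl fun i _ => ?_
      rw [map_sum, ← finSumFinEquiv.sum_comp]
      refine Finset.sum_congr rfl fun j _ => ?_
      rw [← mul_one (N' _ _), ← smul_eq_mul, ← Matrix.smul_single, map_smul, smul_eq_mul, mul_comm]
      simp [hN']
    have hr : N'.rank = N.rank := rank_submatrix _ _ _
    have h0 : N' = 0 := by
      by_contra h
      have := hC N' hmem h
      omega
    ext i j
    have := congrFun (congrFun h0 (finSumFinEquiv i)) (finSumFinEquiv j)
    rw [hN', submatrix_apply, Equiv.symm_apply_apply, Equiv.symm_apply_apply] at this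
    exact this
end
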